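/- arXiv:1601.04275 — 5 statements merged into one kernel-verified Lean document; each statement's English description precedes it below -/
import Mathlib

section
/- Let (X,d) be a compact metric space and let g_1, g_2 : X → X be Ruelle-expanding maps. Then the composition g_2 ∘ g_1 is Ruelle-expanding. Consequently, every composition g_{i_n} ∘ ⋯ ∘ g_{i_1} of finitely many Ruelle-expanding maps of X is Ruelle-expanding. -/
open Filter Topology

/-- A continuous map on a compact metric space is *Ruelle-expanding* if distinct points with the
same image are uniformly separated, and it admits uniformly contracting local inverse branches. -/
def RuelleExpanding {M : Type*} [MetricSpace M] (T : M → M) : Prop :=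
  Continuous T ∧
  (∃ c > 0, ∀ x y : M, x ≠ y → T x = T y → c < dist x y) ∧
  (∃ r > 0, ∃ ρ : ℝ, 0 < ρ ∧ ρ < 1 ∧ ∀ x a : M, T a = x →
    ∃ φ : M → M, φ x = a ∧ (∀ z ∈ Metric.ball x r, T (φ z) = z) ∧
      ∀ z ∈ Metric.ball x r, ∀ w ∈ Metric.ball x r, dist (φ z) (φ w) ≤ ρ * dist z w)

/-- `wordMap g w = g_{w_n} ∘ ⋯ ∘ g_{w_1}` for a word `w = (w_1, …, w_n)`. -/
def wordMap {M : Type*} {p : ℕ} (g : Fin p → M → M) {n : ℕ} (w : Fin n → Fin p) : M → M :=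
  fun x => (List.ofFn w).foldl (fun y i => g i y) x

theorem RuelleExpanding.comp {X : Type*} [MetricSpace X] [CompactSpace X] {f g : X → X}
    (hg : RuelleExpanding g) (hf : RuelleExpanding f) : RuelleExpanding (g ∘ f) := by
  obtain ⟨hfc, ⟨c₁, hc₁, hf_sep⟩, r₁, hr₁, ρ₁, hρ₁, hρ₁', hf_inv⟩ := hf
  obtain ⟨hgc, ⟨c₂, hc₂, hg_sep⟩, r₂, hr₂, ρ₂, hρ₂, hρ₂', hg_inv⟩ := hg
  refine ⟨hgc.comp hfc, ?_, ?_⟩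
  · obtain ⟨δ, hδ, hfδ⟩ := Metric.uniformContinuous_iff.1
      (CompactSpace.uniformContinuous_of_continuous hfc) c₂ hc₂
    refine ⟨min c₁ (δ / 2), lt_min hc₁ (half_pos hδ), fun x y hxy h => ?_⟩
    by_cases hfxy : f x = f y
    · exact (min_le_left _ _).trans_lt (hf_sep x y hxy hfxy)
    · have hδ_le : δ ≤ dist x y := by
        by_contra! hlt
        exact (hfδ hlt).not_gt (hg_sep _ _ hfxy h)
      exact (min_le_right _ _).trans_lt ((half_lt_self hδ).trans_le hδ_le)
  · refine ⟨min r₁ r₂, lt_min hr₁ hr₂, ρ₁ * ρ₂, mul_pos hρ₁ hρ₂,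
      mul_lt_one_of_nonneg_of_lt_one_left hρ₁.le hρ₁' hρ₂'.le, fun x a hx => ?_⟩
    obtain ⟨φ, hφa, hφ_inv, hφ_contr⟩ := hf_inv (f a) a rfl
    obtain ⟨ψ, hψx, hψ_inv, hψ_contr⟩ := hg_inv x (f a) hx
    have mem_ball : ∀ z ∈ Metric.ball x (min r₁ r₂), z ∈ Metric.ball x r₂ :=
      Metric.ball_subset_ball (min_le_right _ _)
    have map_ball : ∀ z ∈ Metric.ball x (min r₁ r₂), ψ z ∈ Metric.ball (f a) r₁ := by
      intro z hz
      rw [Metric.mem_ball, ← hψx]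
      calc dist (ψ z) (ψ x) ≤ ρ₂ * dist z x :=
            hψ_contr z (mem_ball z hz) x (Metric.mem_ball_self hr₂)
        _ ≤ dist z x := mul_le_of_le_one_left dist_nonneg hρ₂'.le
        _ < r₁ := (Metric.mem_ball.1 hz).trans_le (min_le_left _ _)
    refine ⟨φ ∘ ψ, by simp [hψx, hφa], fun z hz => ?_, fun z hz w hw => ?_⟩
    · simp only [Function.comp_apply]
      rw [hφ_inv _ (map_ball z hz), hψ_inv z (mem_ball z hz)]
    · calc dist (φ (ψ z)) (φ (ψ w)) ≤ ρ₁ * dist (ψ z) (ψ w) :=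
            hφ_contr _ (map_ball z hz) _ (map_ball w hw)
        _ ≤ ρ₁ * (ρ₂ * dist z w) :=
            mul_le_mul_of_nonneg_left (hψ_contr z (mem_ball z hz) w (mem_ball w hw)) hρ₁.le
        _ = ρ₁ * ρ₂ * dist z w := (mul_assoc _ _ _).symm

theorem RuelleExpanding.foldl_comp {X ι : Type*} [MetricSpace X] [CompactSpace X]
    {g : ι → X → X} (hg : ∀ i, RuelleExpanding (g i)) (l : List ι) {f : X → X}
    (hf : RuelleExpanding f) : RuelleExpanding (fun x => l.foldl (fun y i => g i y) (f x)) := by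
  induction l generalizing f with
  | nil => exact hf
  | cons i l ih => exact ih ((hg i).comp hf)

/-- The composition of two Ruelle-expanding maps of a compact metric space is Ruelle-expanding;
consequently, every composition of finitely many (at least one) Ruelle-expanding maps is
Ruelle-expanding. -/
theorem ruelleExpanding_comp {X : Type*} [MetricSpace X] [CompactSpace X]
    (g₁ g₂ : X → X) (h₁ : RuelleExpanding g₁) (h₂ : RuelleExpanding g₂) :
    RuelleExpanding (g₂ ∘ g₁) ∧
    ∀ (p n : ℕ) (g : Fin p → X → X), (∀ i, RuelleExpanding (g i)) →
      ∀ w : Fin (n + 1) → Fin p, RuelleExpanding (wordMap g w) := by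
  refine ⟨h₂.comp h₁, fun p n g hg w => ?_⟩
  unfold wordMap
  rw [List.ofFn_succ]
  exact RuelleExpanding.foldl_comp hg (List.ofFn fun i => w i.succ) (hg (w 0))
end

section
/- Let M be a compact connected metric space and let g_1, …, g_p : M → M be Ruelle-expanding maps. Then there exists T ∈ ℕ such that for all m, n ≥ 1: Σ_{w∈{1,…,p}^{m+n+T}} #Fix(g_w) ≥ ( Σ_{u∈{1,…,p}^{n}} #Fix(g_u) ) · ( Σ_{v∈{1,…,p}^{m}} #Fix(g_v) ). Equivalently, the sequence a_n = log( p^{-n} Σ_{|w|=n} #Fix(g_w) ) satisfies a_{m+n+T} ≥ a_m + a_n − T·log p for all m, n ≥ 1. -/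
open Filter Topology

/-- The number of fixed points of `g_w`. -/
noncomputable def fixCard {M : Type*} {p : ℕ} (g : Fin p → M → M) {n : ℕ}
    (w : Fin n → Fin p) : ℕ :=
  Set.ncard {x : M | wordMap g w x = x}

/-- The composition of the maps indexed by the letters of `l`, the first letter acting first. -/
def orbitEnd {ι M : Type*} (g : ι → M → M) (l : List ι) (x : M) : M :=
  l.foldl (fun y i => g i y) x

/-- The orbits of `a` and `b` along the word `l` stay `η`-close at all times. -/
def Shadows {ι M : Type*} [Dist M] (g : ι → M → M) (η : ℝ) : List ι → M → M → Prop
  | [], a, b => dist a b ≤ η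
  | i :: l, a, b => dist a b ≤ η ∧ Shadows g η l (g i a) (g i b)

/-- A family of Ruelle-expanding maps with common constants. -/
structure UniformlyExpanding {ι M : Type*} [MetricSpace M] (g : ι → M → M) (r ρ c : ℝ) :
    Prop where
  continuous : ∀ i, Continuous (g i)
  r_pos : 0 < r
  ρ_pos : 0 < ρ
  ρ_lt_one : ρ < 1
  c_pos : 0 < c
  separated : ∀ i x y, x ≠ y → g i x = g i y → c < dist x y
  exists_branch : ∀ i a, ∃ φ : M → M, φ (g i a) = a ∧
    (∀ z ∈ Metric.ball (g i a) r, g i (φ z) = z) ∧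
    ∀ z ∈ Metric.ball (g i a) r, ∀ w ∈ Metric.ball (g i a) r, dist (φ z) (φ w) ≤ ρ * dist z w

theorem exists_uniformlyExpanding {ι M : Type*} [Finite ι] [Nonempty ι] [MetricSpace M]
    {g : ι → M → M} (hg : ∀ i, RuelleExpanding (g i)) :
    ∃ r ρ c, UniformlyExpanding g r ρ c := by
  choose hcont hsep hbr using hg
  choose c hc hsep using hsep
  choose r hr ρ hρ hρ1 hbr using hbr
  obtain ⟨i, hi⟩ := Finite.exists_min c
  obtain ⟨j, hj⟩ := Finite.exists_min r
  obtain ⟨k, hk⟩ := Finite.exists_max ρ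
  refine ⟨r j, ρ k, c i, hcont, hr j, hρ k, hρ1 k, hc i,
    fun m x y hxy h => (hi m).trans_lt (hsep m x y hxy h), fun m a => ?_⟩
  obtain ⟨φ, h1, h2, h3⟩ := hbr m _ a rfl
  have hsub := Metric.ball_subset_ball (x := g m a) (hj m)
  refine ⟨φ, h1, fun z hz => h2 z (hsub hz), fun z hz w hw => ?_⟩
  exact (h3 z (hsub hz) w (hsub hw)).trans (mul_le_mul_of_nonneg_right (hk m) dist_nonneg)

section Words

variable {ι M : Type*} {g : ι → M → M}

@[simp] theorem orbitEnd_nil (x : M) : orbitEnd g [] x = x := rfl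

@[simp] theorem orbitEnd_cons (i : ι) (l : List ι) (x : M) :
    orbitEnd g (i :: l) x = orbitEnd g l (g i x) := rfl

@[simp] theorem orbitEnd_append (l l' : List ι) (x : M) :
    orbitEnd g (l ++ l') x = orbitEnd g l' (orbitEnd g l x) := by
  simp [orbitEnd]

end Words

namespace Shadows

variable {ι M : Type*} [MetricSpace M] {g : ι → M → M} {η η' : ℝ} {l l' : List ι} {a b d : M}

theorem dist_le (h : Shadows g η l a b) : dist a b ≤ η := by
  cases l with
  | nil => exact h
  | cons i l => exact h.1

theorem mono (hη : η ≤ η') (h : Shadows g η l a b) : Shadows g η' l a b := by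
  induction l generalizing a b with
  | nil => exact le_trans h hη
  | cons i l ih => exact ⟨h.1.trans hη, ih h.2⟩

theorem symm (h : Shadows g η l a b) : Shadows g η l b a := by
  induction l generalizing a b with
  | nil => exact (dist_comm b a).trans_le h
  | cons i l ih => exact ⟨(dist_comm b a).trans_le h.1, ih h.2⟩

theorem trans (h : Shadows g η l a b) (h' : Shadows g η' l b d) :
    Shadows g (η + η') l a d := by
  induction l generalizing a b d with
  | nil => exact (dist_triangle a b d).trans (add_le_add h h')
  | cons i l ih => exact ⟨(dist_triangle a b d).trans (add_le_add h.1 h'.1), ih h.2 h'.2⟩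

theorem left_of_append (h : Shadows g η (l ++ l') a b) : Shadows g η l a b := by
  induction l generalizing a b with
  | nil => exact h.dist_le
  | cons i l ih => exact ⟨h.1, ih h.2⟩

theorem right_of_append (h : Shadows g η (l ++ l') a b) :
    Shadows g η l' (orbitEnd g l a) (orbitEnd g l b) := by
  induction l generalizing a b with
  | nil => exact h
  | cons i l ih => exact ih h.2

end Shadows

namespace UniformlyExpanding

variable {ι M : Type*} [MetricSpace M] {g : ι → M → M} {r ρ c : ℝ}

theorem exists_branch_word (hg : UniformlyExpanding g r ρ c) (l : List ι) (a : M) :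
    ∃ φ : M → M, φ (orbitEnd g l a) = a ∧
      (∀ z ∈ Metric.ball (orbitEnd g l a) r, orbitEnd g l (φ z) = z ∧
        Shadows g (dist z (orbitEnd g l a)) l (φ z) a) ∧
      ∀ z ∈ Metric.ball (orbitEnd g l a) r, ∀ w ∈ Metric.ball (orbitEnd g l a) r,
        dist (φ z) (φ w) ≤ ρ ^ l.length * dist z w := by
  induction l generalizing a with
  | nil => exact ⟨id, rfl, fun z _ => ⟨rfl, le_rfl⟩, fun z _ w _ => by simp⟩
  | cons i l ih =>
    obtain ⟨ψ, h1, h2, h3⟩ := ih (g i a)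
    obtain ⟨χ, k1, k2, k3⟩ := hg.exists_branch i a
    have hψ : ∀ z ∈ Metric.ball (orbitEnd g l (g i a)) r, ψ z ∈ Metric.ball (g i a) r :=
      fun z hz => (h2 z hz).2.dist_le.trans_lt hz
    refine ⟨χ ∘ ψ, by simp [h1, k1], fun z hz => ?_, fun z hz w hw => ?_⟩
    · have hz' := hψ z hz
      have hd : dist (χ (ψ z)) a ≤ dist z (orbitEnd g l (g i a)) := by
        have := k3 _ hz' (g i a) (Metric.mem_ball_self hg.r_pos)
        rw [k1] at this
        refine this.trans (le_trans ?_ (h2 z hz).2.dist_le)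
        exact mul_le_of_le_one_left dist_nonneg hg.ρ_lt_one.le
      refine ⟨?_, hd, ?_⟩
      · simp only [orbitEnd_cons, Function.comp_apply, k2 _ hz']
        exact (h2 z hz).1
      · simp only [orbitEnd_cons, Function.comp_apply, k2 _ hz']
        exact (h2 z hz).2
    · refine (k3 _ (hψ z hz) _ (hψ w hw)).trans ?_
      rw [List.length_cons, pow_succ', mul_assoc]
      exact mul_le_mul_of_nonneg_left (h3 z hz w hw) hg.ρ_pos.le

theorem dist_le_of_shadows (hg : UniformlyExpanding g r ρ c) {δ : ℝ} (hδr : δ < r)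
    (hδc : 2 * δ ≤ c) {l : List ι} {a b : M} (h : Shadows g δ l a b) :
    dist a b ≤ ρ ^ l.length * dist (orbitEnd g l a) (orbitEnd g l b) := by
  induction l generalizing a b with
  | nil => simp
  | cons i l ih =>
    obtain ⟨φ, h1, h2, h3⟩ := hg.exists_branch i a
    have hab : dist (g i a) (g i b) ≤ δ := h.2.dist_le
    have hb : g i b ∈ Metric.ball (g i a) r := by
      rw [Metric.mem_ball, dist_comm]
      exact hab.trans_lt hδr
    have hcontr := h3 _ (Metric.mem_ball_self hg.r_pos) _ hb
    rw [h1] at hcontr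
    have hφ : φ (g i b) = b := by
      by_contra hne
      have hlt := hg.separated i _ _ hne (h2 _ hb)
      have hle : dist a (φ (g i b)) ≤ δ :=
        (hcontr.trans (mul_le_of_le_one_left dist_nonneg hg.ρ_lt_one.le)).trans hab
      have := dist_triangle_left (φ (g i b)) b a
      linarith [h.1]
    rw [hφ] at hcontr
    refine hcontr.trans ?_
    rw [List.length_cons, pow_succ', mul_assoc]
    exact mul_le_mul_of_nonneg_left (ih h.2) hg.ρ_pos.le

theorem eq_of_shadows (hg : UniformlyExpanding g r ρ c) {δ : ℝ} (hδr : δ < r)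
    (hδc : 2 * δ ≤ c) {l : List ι} (hl : l ≠ []) {a b : M} (ha : orbitEnd g l a = a)
    (hb : orbitEnd g l b = b) (h : Shadows g δ l a b) : a = b := by
  have hle := hg.dist_le_of_shadows hδr hδc h
  rw [ha, hb] at hle
  have hlt : ρ ^ l.length < 1 :=
    pow_lt_one₀ hg.ρ_pos.le hg.ρ_lt_one (List.length_pos_iff.2 hl).ne'
  by_contra hne
  nlinarith [dist_pos.2 hne]

theorem eventually_shadows (hg : UniformlyExpanding g r ρ c) {η : ℝ} (hη : 0 < η)
    (l : List ι) (a : M) : ∀ᶠ b in 𝓝 a, Shadows g η l b a := by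
  induction l generalizing a with
  | nil => exact Metric.closedBall_mem_nhds a hη
  | cons i l ih =>
    exact Filter.Eventually.and (Metric.closedBall_mem_nhds a hη)
      ((hg.continuous i).continuousAt.eventually (ih (g i a)))

theorem exists_separation (hg : UniformlyExpanding g r ρ c) :
    ∃ δ, 0 < δ ∧ δ < r ∧ 2 * δ ≤ c := by
  have hr := hg.r_pos
  have hc := hg.c_pos
  refine ⟨min (r / 2) (c / 2), by positivity, ?_, ?_⟩
  · linarith [min_le_left (r / 2) (c / 2)]
  · linarith [min_le_right (r / 2) (c / 2)]

theorem finite_fixed [CompactSpace M] (hg : UniformlyExpanding g r ρ c) {l : List ι}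
    (hl : l ≠ []) : {x | orbitEnd g l x = x}.Finite := by
  obtain ⟨δ, hδ, hδr, hδc⟩ := hg.exists_separation
  obtain ⟨t, -, ht⟩ := isCompact_univ.elim_nhds_subcover _
    fun x (_ : x ∈ Set.univ) => hg.eventually_shadows (half_pos hδ) l x
  refine (t.finite_toSet.biUnion fun y _ => Set.Subsingleton.finite
    (s := {x | orbitEnd g l x = x ∧ Shadows g (δ / 2) l x y}) ?_).subset fun x hx => ?_
  · intro x hx x' hx'
    refine hg.eq_of_shadows hδr hδc hl hx.1 hx'.1 ?_
    simpa using hx.2.trans hx'.2.symm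
  · obtain ⟨y, hy, hxy⟩ := Set.mem_iUnion₂.1 (ht (Set.mem_univ x))
    exact Set.mem_iUnion₂.2 ⟨y, hy, hx, hxy⟩

/-- Preimages under any word can be transported between arbitrary target points at a cost that
decays exponentially in the length of the word. -/
theorem exists_transport [CompactSpace M] [PreconnectedSpace M]
    (hg : UniformlyExpanding g r ρ c) :
    ∃ D : ℝ, ∀ (l : List ι) (a y : M),
      ∃ q, orbitEnd g l q = y ∧ dist a q ≤ ρ ^ l.length * D := by
  let P : ℝ → M → M → Prop := fun D x y => ∀ (l : List ι) (a : M), orbitEnd g l a = x →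
    ∃ q, orbitEnd g l q = y ∧ dist a q ≤ ρ ^ l.length * D
  have hmono : ∀ {D D' x y}, D ≤ D' → P D x y → P D' x y := by
    intro D D' x y hD h l a ha
    obtain ⟨q, hq, hd⟩ := h l a ha
    exact ⟨q, hq, hd.trans (mul_le_mul_of_nonneg_left hD (pow_nonneg hg.ρ_pos.le _))⟩
  have htrans : ∀ {D D' x y z}, P D x y → P D' y z → P (D + D') x z := by
    intro D D' x y z h h' l a ha
    obtain ⟨q, hq, hd⟩ := h l a ha
    obtain ⟨q', hq', hd'⟩ := h' l q hq
    refine ⟨q', hq', (dist_triangle a q q').trans ?_⟩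
    rw [mul_add]
    exact add_le_add hd hd'
  have hclose : ∀ {x y}, dist x y < r → P r x y := by
    rintro _ y hxy l a rfl
    obtain ⟨φ, h1, h2, h3⟩ := hg.exists_branch_word l a
    have hy : y ∈ Metric.ball (orbitEnd g l a) r := by rwa [Metric.mem_ball, dist_comm]
    refine ⟨φ y, (h2 y hy).1, ?_⟩
    have := h3 _ (Metric.mem_ball_self hg.r_pos) y hy
    rw [h1] at this
    exact this.trans (mul_le_mul_of_nonneg_left hxy.le (pow_nonneg hg.ρ_pos.le _))
  have hall : ∀ x y, ∃ D, P D x y := by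
    refine PreconnectedSpace.induction₂' (fun x y => ∃ D, P D x y) (fun x => ?_)
      ⟨fun x y z ⟨D, h⟩ ⟨D', h'⟩ => ⟨D + D', htrans h h'⟩⟩
    filter_upwards [Metric.ball_mem_nhds x hg.r_pos] with y hy
    exact ⟨⟨r, hclose (by rwa [dist_comm])⟩, ⟨r, hclose hy⟩⟩
  choose D hD using hall
  obtain ⟨t, -, htf, ht⟩ := isCompact_univ.finite_cover_balls (X := M) hg.r_pos
  obtain ⟨B, hB⟩ := ((htf.prod htf).image fun s : M × M => D s.1 s.2).bddAbove
  refine ⟨r + B + r, fun l a y => ?_⟩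
  obtain ⟨x', hx', hx⟩ := Set.mem_iUnion₂.1 (ht (Set.mem_univ (orbitEnd g l a)))
  obtain ⟨y', hy', hy⟩ := Set.mem_iUnion₂.1 (ht (Set.mem_univ y))
  have hmid : P B x' y' :=
    hmono (hB ⟨(x', y'), ⟨hx', hy'⟩, rfl⟩) (hD x' y')
  exact htrans (htrans (hclose hx) hmid) (hclose (by rwa [dist_comm])) l a rfl

/-- Two periodic orbits can be glued into one, with gap words of uniform length. -/
theorem exists_glue [CompactSpace M] [PreconnectedSpace M] [Nonempty ι]
    (hg : UniformlyExpanding g r ρ c) {η : ℝ} (hη : 0 < η) :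
    ∃ s : List ι, ∀ (l l' : List ι) (x y : M), l ≠ [] →
      orbitEnd g l x = x → orbitEnd g l' y = y →
      ∃ z, orbitEnd g (l ++ (s ++ (l' ++ s))) z = z ∧ Shadows g η l z x ∧
        Shadows g η l' (orbitEnd g s (orbitEnd g l z)) y := by
  obtain ⟨D, hD⟩ := hg.exists_transport
  have hr := hg.r_pos
  have hρ := hg.ρ_pos
  have hρ1 := hg.ρ_lt_one
  obtain ⟨R, hR, hRr, hRη⟩ : ∃ R, 0 < R ∧ R < r ∧ R + R ≤ η := by
    refine ⟨min (r / 2) (η / 2), by positivity, ?_, ?_⟩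
    · linarith [min_le_left (r / 2) (η / 2)]
    · linarith [min_le_right (r / 2) (η / 2)]
  set ε := (1 - ρ) * R with hε
  have hε0 : 0 < ε := mul_pos (by linarith) hR
  have hεR : ε ≤ R := by nlinarith
  obtain ⟨N, hN⟩ : ∃ N : ℕ, ρ ^ N * D < ε := by
    have h := (tendsto_pow_atTop_nhds_zero_of_lt_one hρ.le hρ1).mul_const D
    rw [zero_mul] at h
    exact (h.eventually_lt_const hε0).exists
  obtain ⟨i⟩ := ‹Nonempty ι›
  refine ⟨List.replicate N i, fun l l' x y hl hx hy => ?_⟩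
  set s := List.replicate N i with hs
  have hgap : ∀ a b : M, ∃ q, orbitEnd g s q = b ∧ dist q a ≤ ε := by
    intro a b
    obtain ⟨q, hq, hd⟩ := hD s a b
    refine ⟨q, hq, ?_⟩
    rw [dist_comm]
    rw [hs, List.length_replicate] at hd
    exact hd.trans hN.le
  have hpull : ∀ (k : List ι) (a q : M), orbitEnd g k a = a → dist q a ≤ ε →
      ∃ q', orbitEnd g k q' = q ∧ Shadows g ε k q' a := by
    intro k a q ha hq
    obtain ⟨φ, -, h2, -⟩ := hg.exists_branch_word k a
    rw [ha] at h2
    obtain ⟨h, h'⟩ := h2 q (hq.trans_lt (hεR.trans_lt hRr))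
    exact ⟨φ q, h, h'.mono hq⟩
  obtain ⟨q₁, hq₁, hd₁⟩ := hgap y x
  obtain ⟨q₂, hq₂, hs₂⟩ := hpull l' y q₁ hy hd₁
  obtain ⟨q₃, hq₃, hd₃⟩ := hgap x q₂
  obtain ⟨q₄, hq₄, hs₄⟩ := hpull l x q₃ hx hd₃
  set W := l ++ (s ++ (l' ++ s)) with hW
  have hWq : orbitEnd g W q₄ = x := by simp [hW, hq₄, hq₃, hq₂, hq₁]
  obtain ⟨ψ, h1, h2, h3⟩ := hg.exists_branch_word W q₄
  rw [hWq] at h1 h2 h3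
  have hsub : Metric.closedBall x R ⊆ Metric.ball x r := Metric.closedBall_subset_ball hRr
  have hpow : ρ ^ W.length ≤ ρ := by
    refine pow_le_of_le_one hρ.le hρ1.le ?_
    simp [hW, hl]
  have hcontr : ∀ z ∈ Metric.closedBall x R, ∀ w ∈ Metric.closedBall x R,
      dist (ψ z) (ψ w) ≤ ρ * dist z w := fun z hz w hw =>
    (h3 z (hsub hz) w (hsub hw)).trans (mul_le_mul_of_nonneg_right hpow dist_nonneg)
  have hxR : x ∈ Metric.closedBall x R := Metric.mem_closedBall_self hR.le
  have hmaps : Set.MapsTo ψ (Metric.closedBall x R) (Metric.closedBall x R) := by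
    intro z hz
    have h := hcontr z hz x hxR
    rw [h1] at h
    have hzR : ρ * dist z x ≤ ρ * R := mul_le_mul_of_nonneg_left hz hρ.le
    rw [Metric.mem_closedBall]
    linarith [dist_triangle (ψ z) q₄ x, hs₄.dist_le]
  have hlip : ContractingWith ⟨ρ, hρ.le⟩ (hmaps.restrict ψ _ _) :=
    ⟨by exact_mod_cast hρ1, LipschitzWith.of_dist_le_mul fun z w => hcontr z z.2 w w.2⟩
  obtain ⟨z, hz, hzfix, -⟩ := hlip.exists_fixedPoint' Metric.isClosed_closedBall.isComplete
    hmaps hxR (edist_ne_top _ _)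
  obtain ⟨hz1, hz2⟩ := h2 z (hsub hz)
  rw [hzfix] at hz1 hz2
  replace hz2 : Shadows g R W z q₄ := hz2.mono hz
  refine ⟨z, hz1, (hz2.left_of_append.trans hs₄).mono (by linarith), ?_⟩
  have h := hz2.right_of_append.right_of_append.left_of_append
  rw [hq₄, hq₃] at h
  exact (h.trans hs₂).mono (by linarith)

end UniformlyExpanding

theorem List.exists_ofFn_eq {α : Type*} {n : ℕ} (l : List α) (hl : l.length = n) :
    ∃ w : Fin n → α, List.ofFn w = l := by
  subst hl
  exact ⟨l.get, List.ofFn_get l⟩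

theorem sum_fixCard_eq_card {M : Type*} {p n : ℕ} (g : Fin p → M → M)
    (hfin : ∀ w : Fin n → Fin p, {x | wordMap g w x = x}.Finite) :
    ∑ w : Fin n → Fin p, fixCard g w =
      Nat.card (Σ w : Fin n → Fin p, {x | wordMap g w x = x}) := by
  have := fun w => (hfin w).to_subtype
  rw [Nat.card_sigma]
  rfl

/-- Almost-superadditivity of the number of periodic points: for a semigroup of Ruelle-expanding
maps on a compact connected metric space there is a gap `T ∈ ℕ` such that
`Σ_{|w| = m+n+T} #Fix(g_w) ≥ (Σ_{|u| = n} #Fix(g_u)) · (Σ_{|v| = m} #Fix(g_v))` for all `m, n ≥ 1`. -/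
theorem fix_count_almost_superadditive
    {M : Type*} [MetricSpace M] [CompactSpace M] [ConnectedSpace M]
    {p : ℕ} (hp : 1 ≤ p) (g : Fin p → M → M) (hg : ∀ i, RuelleExpanding (g i)) :
    ∃ T : ℕ, ∀ m n : ℕ, 1 ≤ m → 1 ≤ n →
      (∑ u : Fin n → Fin p, fixCard g u) * (∑ v : Fin m → Fin p, fixCard g v) ≤
        ∑ w : Fin (m + n + T) → Fin p, fixCard g w := by
  have : Nonempty (Fin p) := ⟨⟨0, hp⟩⟩
  obtain ⟨r, ρ, c, hexp⟩ := exists_uniformlyExpanding hg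
  obtain ⟨δ, hδ, hδr, hδc⟩ := hexp.exists_separation
  obtain ⟨s, hs⟩ := hexp.exists_glue (half_pos hδ)
  have hne : ∀ {k : ℕ} (w : Fin k → Fin p), 1 ≤ k → List.ofFn w ≠ [] := by
    intro k w hk h
    have := congrArg List.length h
    simp at this
    omega
  have hfin : ∀ {k : ℕ} (w : Fin k → Fin p), 1 ≤ k → {x | wordMap g w x = x}.Finite :=
    fun w hk => hexp.finite_fixed (hne w hk)
  refine ⟨s.length + s.length, fun m n hm hn => ?_⟩
  rw [sum_fixCard_eq_card g fun w => hfin w hn, sum_fixCard_eq_card g fun w => hfin w hm,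
    sum_fixCard_eq_card g fun w => hfin w (by omega), ← Nat.card_prod]
  have := fun w : Fin (m + n + (s.length + s.length)) → Fin p =>
    (hfin w (by omega)).to_subtype
  have key : ∀ a : (Σ u : Fin n → Fin p, {x | wordMap g u x = x}) ×
      (Σ v : Fin m → Fin p, {x | wordMap g v x = x}),
      ∃ b : Σ w : Fin (m + n + (s.length + s.length)) → Fin p, {x | wordMap g w x = x},
        List.ofFn b.1 = List.ofFn a.1.1 ++ (s ++ (List.ofFn a.2.1 ++ s)) ∧
        Shadows g (δ / 2) (List.ofFn a.1.1) b.2 a.1.2 ∧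
        Shadows g (δ / 2) (List.ofFn a.2.1)
          (orbitEnd g s (orbitEnd g (List.ofFn a.1.1) b.2)) a.2.2 := by
    rintro ⟨⟨u, x, hx⟩, ⟨v, y, hy⟩⟩
    obtain ⟨z, hz, hzx, hzy⟩ := hs (List.ofFn u) (List.ofFn v) x y (hne u hn) hx hy
    obtain ⟨w, hw⟩ := List.exists_ofFn_eq (n := m + n + (s.length + s.length))
      (List.ofFn u ++ (s ++ (List.ofFn v ++ s))) (by simp; omega)
    refine ⟨⟨w, z, ?_⟩, hw, hzx, hzy⟩
    rw [← hw] at hz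
    exact hz
  choose F hFw hFx hFy using key
  refine Nat.card_le_card_of_injective F fun a a' haa => ?_
  have hw := hFw a
  have hx := hFx a
  have hy := hFy a
  rw [haa] at hw hx hy
  rw [hFw a'] at hw
  have hx' := hFx a'
  have hy' := hFy a'
  generalize F a' = b at hx hy hx' hy'
  obtain ⟨⟨u, x, hxf⟩, ⟨v, y, hyf⟩⟩ := a
  obtain ⟨⟨u', x', hxf'⟩, ⟨v', y', hyf'⟩⟩ := a'
  obtain ⟨hu, hw⟩ := List.append_inj hw (by simp)
  obtain ⟨hv, -⟩ := List.append_inj (List.append_cancel_left hw) (by simp)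
  obtain rfl := List.ofFn_injective hu
  obtain rfl := List.ofFn_injective hv
  have hxx : x = x' := hexp.eq_of_shadows hδr hδc (hne u' hn) hxf hxf'
    (by simpa using hx.symm.trans hx')
  have hyy : y = y' := hexp.eq_of_shadows hδr hδc (hne v' hm) hyf hyf'
    (by simpa using hy.symm.trans hy')
  subst hxx hyy
  rfl
end

section
/- Let (a_n)_{n≥1} be a sequence of real numbers and T ∈ ℕ be such that a_{m+n+T} ≥ a_m + a_n for all m, n ≥ 1, and suppose sup_{n≥1} a_n/n < ∞. Then the limit lim_{n→∞} a_n/n exists and equals sup_{k≥1} a_k/(k+T). -/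
open Filter Topology

/-- Iterating the gapped superadditivity along an arithmetic progression of step `k + T`. -/
theorem mul_add_le_of_superadditive_gap {a : ℕ → ℝ} {T : ℕ}
    (hsuper : ∀ m n : ℕ, 1 ≤ m → 1 ≤ n → a m + a n ≤ a (m + n + T))
    {k s : ℕ} (hk : 1 ≤ k) (hs : 1 ≤ s) (q : ℕ) :
    q * a k + a s ≤ a ((k + T) * q + s) := by
  induction q with
  | zero => simp
  | succ q ih =>
    have h := hsuper ((k + T) * q + s) k (by omega) hk
    rw [show (k + T) * q + s + k + T = (k + T) * (q + 1) + s by ring] at h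
    push_cast
    linarith

/-- Every number below some `a k / (k + T)` is eventually below `a n / n`. -/
theorem eventually_lt_div_of_superadditive_gap {a : ℕ → ℝ} {T : ℕ}
    (hsuper : ∀ m n : ℕ, 1 ≤ m → 1 ≤ n → a m + a n ≤ a (m + n + T))
    {k : ℕ} (hk : 1 ≤ k) {l : ℝ} (hl : l < a k / ((k : ℝ) + T)) :
    ∀ᶠ n : ℕ in atTop, l < a n / n := by
  have hN : (0 : ℝ) < (k : ℝ) + T := by positivity
  rw [lt_div_iff₀ hN] at hl
  refine .atTop_of_arithmetic (n := k + T) (by omega) fun r _ => ?_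
  have hlim : Tendsto (fun q : ℕ => (q : ℝ) * (a k - l * (k + T))) atTop atTop :=
    tendsto_natCast_atTop_atTop.atTop_mul_const (sub_pos.2 hl)
  filter_upwards [hlim.eventually_gt_atTop (l * r + a k - a (k + T + r)),
    eventually_ge_atTop 1] with q hq hq1
  obtain ⟨p, rfl⟩ : ∃ p, q = p + 1 := ⟨q - 1, by omega⟩
  have h := mul_add_le_of_superadditive_gap hsuper hk (s := k + T + r) (by omega) p
  rw [show (k + T) * p + (k + T + r) = (k + T) * (p + 1) + r by ring] at h
  have hpos : (0 : ℝ) < (((k + T) * (p + 1) + r : ℕ) : ℝ) := by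
    push_cast
    positivity
  rw [lt_div_iff₀ hpos]
  push_cast at hq ⊢
  linarith

/-- **Fekete's lemma with a gap.** If a real sequence satisfies `a_{m+n+T} ≥ a_m + a_n` for all
`m, n ≥ 1` and `sup_{n ≥ 1} a_n / n < ∞`, then `lim_{n→∞} a_n / n` exists and equals
`sup_{k ≥ 1} a_k / (k + T)`. -/
theorem fekete_with_gap (a : ℕ → ℝ) (T : ℕ)
    (hsuper : ∀ m n : ℕ, 1 ≤ m → 1 ≤ n → a m + a n ≤ a (m + n + T))
    (hbdd : BddAbove (Set.range (fun n : ℕ => a (n + 1) / (n + 1)))) :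
    Filter.Tendsto (fun n : ℕ => a n / n) Filter.atTop
      (𝓝 (⨆ k : ℕ, a (k + 1) / ((k + 1 : ℕ) + (T : ℝ)))) := by
  have hbdd' : BddAbove (Set.range fun k : ℕ => a (k + 1) / ((k + 1 : ℕ) + (T : ℝ))) := by
    obtain ⟨C, hC⟩ := hbdd
    refine ⟨|C|, ?_⟩
    rintro _ ⟨k, rfl⟩
    have h : a (k + 1) / ((k : ℝ) + 1) ≤ C := hC ⟨k, rfl⟩
    rw [div_le_iff₀ (by positivity)] at h
    rw [div_le_iff₀ (by positivity)]
    calc a (k + 1) ≤ C * ((k : ℝ) + 1) := h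
      _ ≤ |C| * ((k : ℝ) + 1) := by gcongr; exact le_abs_self C
      _ ≤ |C| * ((k + 1 : ℕ) + (T : ℝ)) := by
        push_cast
        exact mul_le_mul_of_nonneg_left (by simp) (abs_nonneg C)
  set S := ⨆ k : ℕ, a (k + 1) / ((k + 1 : ℕ) + (T : ℝ))
  refine tendsto_order.2 ⟨fun l hl => ?_, fun L hL => ?_⟩
  · obtain ⟨k, hk⟩ := exists_lt_of_lt_ciSup hl
    exact eventually_lt_div_of_superadditive_gap hsuper (Nat.le_add_left 1 k) hk
  · have hlim : Tendsto (fun n : ℕ => (n : ℝ) * (L - S)) atTop atTop :=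
      tendsto_natCast_atTop_atTop.atTop_mul_const (sub_pos.2 hL)
    filter_upwards [hlim.eventually_gt_atTop (S * T), eventually_ge_atTop 1] with n hn hn1
    obtain ⟨k, rfl⟩ : ∃ k, n = k + 1 := ⟨n - 1, by omega⟩
    have h : a (k + 1) / ((k + 1 : ℕ) + (T : ℝ)) ≤ S := le_ciSup hbdd' k
    rw [div_le_iff₀ (by positivity)] at h
    rw [div_lt_iff₀ (by positivity)]
    linarith
end

section
/- Let M be a compact metric space and let g_1, …, g_p : M → M be Ruelle-expanding maps. Let Σ_p^+ = {1,…,p}^ℕ carry the shift σ and the metric d_Σ(ω,ω') = 2^{-min{k : ω_k ≠ ω'_k}} (and d_Σ(ω,ω) = 0), and let the product Σ_p^+ × M carry the metric D((ω,x),(ω',x')) = max{d_Σ(ω,ω'), d(x,x')}. Then the skew-product F_G : Σ_p^+ × M → Σ_p^+ × M, F_G(ω,x) = (σ(ω), g_{ω_1}(x)), is Ruelle-expanding. -/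
open Filter Topology

/-- The one-sided shift `σ(ω)_k = ω_{k+1}` on `Σ_p^+ = {1,…,p}^ℕ`. -/
def shiftMap {p : ℕ} (ω : ℕ → Fin p) : ℕ → Fin p := fun k => ω (k + 1)

/-- The skew-product `F_G(ω, x) = (σ(ω), g_{ω_1}(x))`. -/
def skewProduct {M : Type*} {p : ℕ} (g : Fin p → M → M) :
    (ℕ → Fin p) × M → (ℕ → Fin p) × M :=
  fun q => (shiftMap q.1, g (q.1 0) q.2)

/-- The sequence obtained by prepending the letter `i` to `ω`. -/
def prependLetter {p : ℕ} (i : Fin p) (ω : ℕ → Fin p) : ℕ → Fin p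
  | 0 => i
  | k + 1 => ω k

theorem PiNat.dist_le_half_mul_dist_shiftMap {p : ℕ} {ω η : ℕ → Fin p} (h0 : ω 0 = η 0) :
    letI : MetricSpace (ℕ → Fin p) := PiNat.metricSpace
    dist ω η ≤ 1 / 2 * dist (shiftMap ω) (shiftMap η) := by
  let _ : MetricSpace (ℕ → Fin p) := PiNat.metricSpace
  by_cases h : shiftMap ω = shiftMap η
  · have : ω = η := by
      funext k
      cases k with
      | zero => exact h0
      | succ k => exact congrFun h k
    simp [this]
  · have hc : ω ∈ PiNat.cylinder η (PiNat.firstDiff (shiftMap ω) (shiftMap η) + 1) := by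
      intro k hk
      cases k with
      | zero => exact h0
      | succ k =>
        exact PiNat.apply_eq_of_lt_firstDiff (x := shiftMap ω) (y := shiftMap η) (by omega)
    have hd : dist (shiftMap ω) (shiftMap η) =
        (1 / 2) ^ PiNat.firstDiff (shiftMap ω) (shiftMap η) := PiNat.dist_eq_of_ne h
    rw [hd, ← pow_succ']
    exact PiNat.mem_cylinder_iff_dist_le.1 hc

theorem continuous_shiftMap {p : ℕ} : Continuous (shiftMap : (ℕ → Fin p) → ℕ → Fin p) :=
  continuous_pi fun k => continuous_apply (k + 1)

theorem continuous_skewProduct {M : Type*} [TopologicalSpace M] {p : ℕ} {g : Fin p → M → M}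
    (hg : ∀ i, Continuous (g i)) : Continuous (skewProduct g) := by
  have h : Continuous fun q : Fin p × M => g q.1 q.2 := continuous_prod_of_discrete_left.2 hg
  have h0 : Continuous fun q : (ℕ → Fin p) × M => (q.1 0, q.2) :=
    ((continuous_apply 0).comp continuous_fst).prodMk continuous_snd
  exact (continuous_shiftMap.comp continuous_fst).prodMk (h.comp h0)

theorem exists_pos_lt_of_finite {ι : Type*} [Finite ι] {f : ι → ℝ} (hf : ∀ i, 0 < f i) :
    ∃ c, 0 < c ∧ c < 1 ∧ ∀ i, c < f i := by
  have h1 : ∀ᶠ c in 𝓝[>] (0 : ℝ), ∀ i, c < f i :=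
    eventually_all.2 fun i => nhdsWithin_le_nhds (eventually_lt_nhds (hf i))
  have h2 : ∀ᶠ c in 𝓝[>] (0 : ℝ), c < 1 :=
    nhdsWithin_le_nhds (eventually_lt_nhds one_pos)
  have h3 : ∀ᶠ c in 𝓝[>] (0 : ℝ), 0 < c := self_mem_nhdsWithin
  obtain ⟨c, hc1, hc2, hc3⟩ := (h1.and (h2.and h3)).exists
  exact ⟨c, hc3, hc2, hc1⟩

/-- If `g_1, …, g_p` are Ruelle-expanding maps on a compact metric space `M`, then the
skew-product `F_G(ω,x) = (σ(ω), g_{ω_1}(x))` is Ruelle-expanding on `Σ_p^+ × M`, where `Σ_p^+`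
carries the metric `d_Σ(ω, ω') = 2^{-min{k : ω_k ≠ ω'_k}}` (the `PiNat` metric) and the product
carries the corresponding max metric. -/
theorem skewProduct_ruelleExpanding
    {M : Type*} [MetricSpace M] [CompactSpace M]
    {p : ℕ} (g : Fin p → M → M) (hg : ∀ i, RuelleExpanding (g i)) :
    letI : MetricSpace (ℕ → Fin p) := PiNat.metricSpace
    RuelleExpanding (skewProduct g) := by
  let _ : MetricSpace (ℕ → Fin p) := PiNat.metricSpace
  have hcont := fun i => (hg i).1
  choose c hc hsep using fun i => (hg i).2.1
  choose r hr ρ _ hρ1 hφ using fun i => (hg i).2.2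
  refine ⟨continuous_skewProduct hcont, ?_, ?_⟩
  · obtain ⟨c', hc'0, hc'1, hc'⟩ := exists_pos_lt_of_finite hc
    refine ⟨c', hc'0, ?_⟩
    rintro ⟨ω, x⟩ ⟨η, y⟩ hne heq
    obtain ⟨hshift, hxy⟩ := Prod.mk.inj heq
    rw [Prod.dist_eq, lt_max_iff]
    dsimp only at hshift hxy ⊢
    by_cases h0 : ω 0 = η 0
    · right
      have hωη : ω = η := by
        funext k
        cases k with
        | zero => exact h0
        | succ k => exact congrFun hshift k
      subst hωη
      exact (hc' _).trans (hsep (ω 0) x y (fun h => hne (by rw [h])) hxy)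
    · left
      have hd : dist ω η = (1 / 2) ^ PiNat.firstDiff ω η :=
        PiNat.dist_eq_of_ne fun h => h0 (congrFun h 0)
      have hz : PiNat.firstDiff ω η = 0 := by
        by_contra h
        exact h0 (PiNat.apply_eq_of_lt_firstDiff (Nat.pos_of_ne_zero h))
      rwa [hd, hz, pow_zero]
  · obtain ⟨r', hr'0, -, hr'⟩ := exists_pos_lt_of_finite hr
    obtain ⟨δ, hδ0, hδ1, hδ⟩ := exists_pos_lt_of_finite fun i => sub_pos.2 (hρ1 i)
    refine ⟨r', hr'0, max (1 / 2) (1 - δ), by positivity,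
      max_lt (by norm_num) (by linarith), ?_⟩
    rintro ⟨ω, x⟩ ⟨α, a⟩ h
    obtain ⟨hα, ha⟩ := Prod.mk.inj h
    dsimp only at hα ha
    obtain ⟨φ, hφx, hφT, hφρ⟩ := hφ (α 0) x a ha
    have hball : ∀ z ∈ Metric.ball (ω, x) r', z.2 ∈ Metric.ball x (r (α 0)) := fun z hz =>
      ((le_max_right _ _).trans_lt (Metric.mem_ball.1 hz)).trans (hr' _)
    refine ⟨fun z => (prependLetter (α 0) z.1, φ z.2), ?_, ?_, ?_⟩
    · refine Prod.ext ?_ hφx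
      funext k
      cases k with
      | zero => rfl
      | succ k => exact (congrFun hα k).symm
    · exact fun z hz => Prod.ext rfl (hφT _ (hball z hz))
    · intro z hz w hw
      have hρ : ρ (α 0) ≤ 1 - δ := by linarith [hδ (α 0)]
      refine max_le ?_ ?_
      · have hd : dist (prependLetter (α 0) z.1) (prependLetter (α 0) w.1) ≤
            1 / 2 * dist z.1 w.1 := PiNat.dist_le_half_mul_dist_shiftMap rfl
        refine hd.trans ?_
        exact mul_le_mul (le_max_left _ _) (le_max_left _ _) dist_nonneg (by positivity)
      · refine (hφρ _ (hball z hz) _ (hball w hw)).trans ?_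
        exact mul_le_mul (hρ.trans (le_max_right _ _)) (le_max_right _ _) dist_nonneg
          (by positivity)
end

section
/- Let M be a compact connected metric space and let g_1, …, g_p : M → M be Ruelle-expanding maps. Then the skew-product F_G : Σ_p^+ × M → Σ_p^+ × M, F_G(ω,x) = (σ(ω), g_{ω_1}(x)), is topologically mixing: for all nonempty open sets U, V ⊆ Σ_p^+ × M there exists N ∈ ℕ such that F_G^n(U) ∩ V ≠ ∅ for every n ≥ N. -/
open Filter Topology

/-- Points `r`-close to `T a` lift through `T` to points near `a`, with
distances contracted by the factor `ρ`. -/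
def ContractingLifts {X Y : Type*} [PseudoMetricSpace X] [PseudoMetricSpace Y]
    (T : X → Y) (r ρ : ℝ) : Prop :=
  ∀ a z, dist (T a) z < r → ∃ w, T w = z ∧ dist a w ≤ ρ * dist (T a) z

theorem RuelleExpanding.exists_contractingLifts {M : Type*} [MetricSpace M] {T : M → M}
    (hT : RuelleExpanding T) : ∃ r > 0, ∃ ρ : ℝ, 0 < ρ ∧ ρ < 1 ∧ ContractingLifts T r ρ := by
  obtain ⟨-, -, r, hr, ρ, h0, h1, h⟩ := hT
  refine ⟨r, hr, ρ, h0, h1, fun a z hz => ?_⟩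
  obtain ⟨φ, hφ, hinv, hcontr⟩ := h (T a) a rfl
  have hz' : z ∈ Metric.ball (T a) r := by rwa [Metric.mem_ball, dist_comm]
  refine ⟨φ z, hinv z hz', ?_⟩
  simpa only [hφ] using hcontr (T a) (Metric.mem_ball_self hr) z hz'

namespace ContractingLifts

theorem mono {X Y : Type*} [PseudoMetricSpace X] [PseudoMetricSpace Y] {T : X → Y}
    {r r' ρ ρ' : ℝ} (h : ContractingLifts T r ρ) (hr : r' ≤ r) (hρ : ρ ≤ ρ') :
    ContractingLifts T r' ρ' := by
  intro a z hz
  obtain ⟨w, hw, hd⟩ := h a z (hz.trans_le hr)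
  exact ⟨w, hw, hd.trans (by gcongr)⟩

theorem comp {X Y Z : Type*} [PseudoMetricSpace X] [PseudoMetricSpace Y] [PseudoMetricSpace Z]
    {S : Y → Z} {T : X → Y} {r ρ ρ' : ℝ} (hS : ContractingLifts S r ρ') (hT : ContractingLifts T r ρ)
    (hρ : 0 ≤ ρ) (hρ' : ρ' ≤ 1) : ContractingLifts (S ∘ T) r (ρ * ρ') := by
  intro a z hz
  obtain ⟨y, rfl, hy⟩ := hS (T a) z hz
  have hle : dist (T a) y ≤ dist (S (T a)) (S y) :=
    hy.trans (mul_le_of_le_one_left dist_nonneg hρ')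
  obtain ⟨w, rfl, hw⟩ := hT a y (hle.trans_lt hz)
  refine ⟨w, rfl, hw.trans ?_⟩
  rw [mul_assoc]
  exact mul_le_mul_of_nonneg_left hy hρ

/-- Lifting a chain of `K` steps of length less than `r`. -/
theorem exists_of_mem_iterate_thickening {X Y : Type*} [PseudoMetricSpace X]
    [PseudoMetricSpace Y] {T : X → Y} {r ρ : ℝ} (h : ContractingLifts T r ρ) (hρ : 0 ≤ ρ) (y : Y)
    (K : ℕ) (a : X) (ha : T a ∈ (Metric.thickening r)^[K] {y}) :
    ∃ w, T w = y ∧ dist a w ≤ K * (ρ * r) := by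
  induction K generalizing a with
  | zero => exact ⟨a, by simpa using ha, by simp⟩
  | succ K ih =>
    rw [Function.iterate_succ_apply', Metric.mem_thickening_iff] at ha
    obtain ⟨b, hb, hab⟩ := ha
    obtain ⟨a', rfl, ha'⟩ := h a b hab
    obtain ⟨w, hw, hd⟩ := ih a' hb
    refine ⟨w, hw, (dist_triangle a a' w).trans ?_⟩
    have : ρ * dist (T a) (T a') ≤ ρ * r := by gcongr
    push_cast
    linarith

end ContractingLifts

/-- In a compact connected space, chains of a bounded number of steps of length less than `r` join
any point to a given one. -/
theorem exists_iterate_thickening_eq_univ {M : Type*} [PseudoMetricSpace M] [CompactSpace M]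
    [ConnectedSpace M] {r : ℝ} (hr : 0 < r) (y : M) :
    ∃ K : ℕ, (Metric.thickening r)^[K] {y} = Set.univ := by
  set S : ℕ → Set M := fun K => (Metric.thickening r)^[K] {y}
  have hS : ∀ K, S (K + 1) = Metric.thickening r (S K) := fun K =>
    Function.iterate_succ_apply' _ _ _
  have hmono : Monotone S := monotone_nat_of_le_succ fun K => by
    rw [hS]; exact Metric.self_subset_thickening hr _
  have hthick : Metric.thickening r (⋃ K, S K) ⊆ ⋃ K, S K := by
    intro a ha
    obtain ⟨b, hb, hab⟩ := Metric.mem_thickening_iff.1 ha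
    obtain ⟨K, hK⟩ := Set.mem_iUnion.1 hb
    refine Set.mem_iUnion.2 ⟨K + 1, ?_⟩
    rw [hS]
    exact Metric.mem_thickening_iff.2 ⟨b, hK, hab⟩
  have hclopen : IsClopen (⋃ K, S K) := by
    constructor
    · exact isClosed_of_closure_subset
        ((Metric.closure_subset_thickening hr _).trans hthick)
    · rw [← hthick.antisymm (Metric.self_subset_thickening hr _)]
      exact Metric.isOpen_thickening
  have huniv : ⋃ K, S K = Set.univ :=
    hclopen.eq_univ ⟨y, Set.mem_iUnion.2 ⟨0, Set.mem_singleton y⟩⟩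
  have hcover : Set.univ ⊆ ⋃ K, S (K + 1) := by
    rw [← huniv]
    exact Set.iUnion_mono fun K => hmono K.le_succ
  obtain ⟨K, hK⟩ := isCompact_univ.elim_directed_cover (fun K => S (K + 1))
    (fun K => by rw [hS]; exact Metric.isOpen_thickening) hcover
    (hmono.comp (Order.succ_mono (α := ℕ))).directed_le
  exact ⟨K + 1, Set.univ_subset_iff.1 hK⟩

theorem skewProduct_iterate_fst {M : Type*} {p : ℕ} (g : Fin p → M → M) (n : ℕ)
    (q : (ℕ → Fin p) × M) : ((skewProduct g)^[n] q).1 = fun k => q.1 (k + n) := by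
  induction n generalizing q with
  | zero => rfl
  | succ n ih =>
    rw [Function.iterate_succ_apply, ih]
    rfl

theorem contractingLifts_skewProduct_iterate {M : Type*} [PseudoMetricSpace M] {p : ℕ}
    {g : Fin p → M → M} {r ρ : ℝ} (hρ : 0 ≤ ρ) (hρ' : ρ ≤ 1)
    (hg : ∀ i, ContractingLifts (g i) r ρ) (n : ℕ) (ω : ℕ → Fin p) :
    ContractingLifts (fun x => ((skewProduct g)^[n] (ω, x)).2) r (ρ ^ n) := by
  induction n generalizing ω with
  | zero => exact fun a z _ => ⟨z, rfl, by simp⟩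
  | succ n ih =>
    rw [pow_succ']
    exact (ih (shiftMap ω)).comp (hg (ω 0)) hρ (pow_le_one₀ hρ hρ')

/-- If `g_1, …, g_p` are Ruelle-expanding maps on a compact connected metric space `M`, then the
skew-product `F_G(ω,x) = (σ(ω), g_{ω_1}(x))` on `Σ_p^+ × M` (with the product topology) is
topologically mixing: any nonempty open set eventually intersects any other under iteration. -/
theorem skewProduct_topologically_mixing
    {M : Type*} [MetricSpace M] [CompactSpace M] [ConnectedSpace M]
    {p : ℕ} (g : Fin p → M → M) (hg : ∀ i, RuelleExpanding (g i)) :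
    ∀ U V : Set ((ℕ → Fin p) × M), IsOpen U → U.Nonempty → IsOpen V → V.Nonempty →
      ∃ N : ℕ, ∀ n : ℕ, N ≤ n → ((skewProduct g)^[n] '' U ∩ V).Nonempty := by
  rintro U V hU ⟨⟨ω, x⟩, hx⟩ - ⟨⟨η, y⟩, hy⟩
  choose r hr ρ hρ0 hρ1 hlift using fun i => (hg i).exists_contractingLifts
  have : Nonempty (Fin p) := ⟨ω 0⟩
  obtain ⟨i, hi⟩ := Finite.exists_min r
  obtain ⟨j, hj⟩ := Finite.exists_max ρ
  obtain ⟨K, hK⟩ := exists_iterate_thickening_eq_univ (hr i) y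
  let θ : ℕ → ℕ → Fin p := fun n k => if k < n then ω k else η (k - n)
  have hex : ∀ n, ∃ w, ((skewProduct g)^[n] (θ n, w)).2 = y ∧
      dist x w ≤ K * (ρ j ^ n * r i) := fun n =>
    (contractingLifts_skewProduct_iterate (hρ0 j).le (hρ1 j).le
      (fun k => (hlift k).mono (hi k) (hj k)) n (θ n)).exists_of_mem_iterate_thickening
      (pow_nonneg (hρ0 j).le n) y K x (hK ▸ Set.mem_univ _)
  choose w hw hxw using hex
  have hθ : Tendsto θ atTop (𝓝 ω) := by
    refine tendsto_pi_nhds.2 fun k => tendsto_const_nhds.congr' ?_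
    filter_upwards [eventually_gt_atTop k] with n hn
    exact (if_pos hn).symm
  have hbound : Tendsto (fun n : ℕ => K * (ρ j ^ n * r i)) atTop (𝓝 0) := by
    simpa using ((tendsto_pow_atTop_nhds_zero_of_lt_one (hρ0 j).le (hρ1 j)).mul_const
      (r i)).const_mul (K : ℝ)
  have hwx : Tendsto w atTop (𝓝 x) := tendsto_iff_dist_tendsto_zero.2 <|
    squeeze_zero (fun _ => dist_nonneg) (fun n => by rw [dist_comm]; exact hxw n) hbound
  obtain ⟨N, hN⟩ := eventually_atTop.1
    ((hθ.prodMk_nhds hwx).eventually (hU.mem_nhds hx))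
  refine ⟨N, fun n hn => ⟨(η, y), ⟨(θ n, w n), hN n hn, Prod.ext ?_ (hw n)⟩, hy⟩⟩
  rw [skewProduct_iterate_fst]
  funext k
  simp [θ]
end
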